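/- arXiv:2406.15322 — 2 statements merged into one kernel-verified Lean document; each statement's English description precedes it below -/
import Mathlib

section
/- Let n be odd, L a 2-linear polynomial over F_{q^n} such that Tr(x^{q+1}) + L(x) is a permutation polynomial of F_{q^n}, and λ a 2-linear polynomial over F_{q^n} with λ'(ker Tr) = ker Tr and Tr(λ'(x)) = Tr(x) for all x ∈ F_{q^n}. Then both Tr(x^{q+1}) + L(λ(x)) and Tr(x^{q+1}) + λ(L(x)) are permutation polynomials of F_{q^n}. -/
section PowerSumTrace

variable {F : Type*} [Field F]

/-- The sum of the first `n` iterated `q`-th powers of `x`: the trace of `x` over the subfield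
with `q` elements when the ambient field has `q ^ n` elements. -/
def powSumTrace (q n : ℕ) (x : F) : F := ∑ i ∈ Finset.range n, x ^ q ^ i

theorem powSumTrace_zero {q : ℕ} (hq : q ≠ 0) (n : ℕ) : powSumTrace q n (0 : F) = 0 := by
  simp [powSumTrace, hq]

theorem powSumTrace_add [CharP F 2] (m n : ℕ) (x y : F) :
    powSumTrace (2 ^ m) n (x + y) = powSumTrace (2 ^ m) n x + powSumTrace (2 ^ m) n y := by
  simp [powSumTrace, ← pow_mul, add_pow_char_pow, Finset.sum_add_distrib]

theorem powSumTrace_pow {q n : ℕ} {x : F} (hx : x ^ q ^ n = x) :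
    powSumTrace q n (x ^ q) = powSumTrace q n x := by
  have h := (Finset.sum_range_succ (fun i => x ^ q ^ i) n).symm.trans
    (Finset.sum_range_succ' (fun i => x ^ q ^ i) n)
  simp only [hx, pow_zero, pow_one] at h
  simpa [powSumTrace, ← pow_mul, ← pow_succ'] using (add_right_cancel h).symm

theorem pow_pow_eq_self {q : ℕ} {c : F} (hc : c ^ q = c) (i : ℕ) : c ^ q ^ i = c := by
  induction i with
  | zero => simp
  | succ i ih => rw [pow_succ, pow_mul, ih, hc]

theorem powSumTrace_mul {q : ℕ} {c : F} (hc : c ^ q = c) (n : ℕ) (x : F) :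
    powSumTrace q n (c * x) = c * powSumTrace q n x := by
  simp [powSumTrace, mul_pow, pow_pow_eq_self hc, Finset.mul_sum]

theorem powSumTrace_pow_eq_self [CharP F 2] {m n : ℕ} {x : F}
    (hx : x ^ (2 ^ m) ^ n = x) :
    powSumTrace (2 ^ m) n x ^ 2 ^ m = powSumTrace (2 ^ m) n x := by
  conv_rhs => rw [← powSumTrace_pow hx]
  simp only [powSumTrace, sum_pow_char_pow 2, ← pow_mul, mul_comm]

theorem powSumTrace_eq_self [CharP F 2] {q n : ℕ} (hn : Odd n) {c : F} (hc : c ^ q = c) :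
    powSumTrace q n c = c := by
  obtain ⟨k, rfl⟩ := hn
  simp [powSumTrace, pow_pow_eq_self hc, CharTwo.two_eq_zero]

theorem sum_powSumTrace_pow [CharP F 2] (m n : ℕ) (x : F) :
    ∑ j ∈ Finset.range m, powSumTrace (2 ^ m) n x ^ 2 ^ j =
      ∑ i ∈ Finset.range (m * n), x ^ 2 ^ i := by
  induction n with
  | zero => simp [powSumTrace]
  | succ n ih =>
    rw [Nat.mul_succ, Finset.sum_range_add, ← ih, ← Finset.sum_add_distrib]
    refine Finset.sum_congr rfl fun j _ => ?_
    rw [powSumTrace, Finset.sum_range_succ, add_pow_char_pow, powSumTrace, ← pow_mul x, ← pow_mul 2,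
      ← pow_add]

theorem pow_eq_self_of_pow_sq_eq_self {q n : ℕ} (hn : Odd n) {a : F}
    (han : a ^ q ^ n = a) (ha : a ^ q ^ 2 = a) : a ^ q = a := by
  obtain ⟨k, rfl⟩ := hn
  rwa [pow_succ, pow_mul, pow_mul q, pow_pow_eq_self ha] at han

theorem sum_mul_two_pow_add [CharP F 2] {N : ℕ} (c : Fin N → F) (x y : F) :
    ∑ i, c i * (x + y) ^ 2 ^ (i : ℕ) =
      ∑ i, c i * x ^ 2 ^ (i : ℕ) + ∑ i, c i * y ^ 2 ^ (i : ℕ) := by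
  simp [add_pow_char_pow, mul_add, Finset.sum_add_distrib]

end PowerSumTrace

section FiniteField

variable {F : Type*} [Field F] [Fintype F]

theorem trace_pow_two_pow [Algebra (ZMod 2) F] (i : ℕ) (x : F) :
    Algebra.trace (ZMod 2) F (x ^ 2 ^ i) = Algebra.trace (ZMod 2) F x := by
  induction i with
  | zero => simp
  | succ i ih =>
    rw [pow_succ, pow_mul, ← ih]
    simpa [ZMod.card] using Algebra.trace_eq_of_algEquiv
      (FiniteField.frobeniusAlgEquivOfAlgebraic (ZMod 2) F) (x ^ 2 ^ i)

theorem eq_zero_of_trace_mul_eq_zero [Algebra (ZMod 2) F] {b : F}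
    (h : ∀ a, Algebra.trace (ZMod 2) F (a * b) = 0) : b = 0 :=
  (traceForm_nondegenerate (ZMod 2) F).2 b fun a => by simpa [Algebra.traceForm_apply] using h a

theorem algebraMap_trace_eq_sum_powSumTrace [CharP F 2] [Algebra (ZMod 2) F] {m n : ℕ}
    (hF : Fintype.card F = 2 ^ (m * n)) (x : F) :
    algebraMap (ZMod 2) F (Algebra.trace (ZMod 2) F x) =
      ∑ j ∈ Finset.range m, powSumTrace (2 ^ m) n x ^ 2 ^ j := by
  have hr : Module.finrank (ZMod 2) F = m * n := by
    have h := Module.card_eq_pow_finrank (K := ZMod 2) (V := F)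
    rw [hF, ZMod.card] at h
    exact (Nat.pow_right_injective le_rfl h).symm
  rw [FiniteField.algebraMap_trace_eq_sum_pow, sum_powSumTrace_pow, hr]
  simp [ZMod.card]

theorem trace_mul_sum_eq_trace_sum_mul [Algebra (ZMod 2) F] {N : ℕ}
    (hF : Fintype.card F = 2 ^ N) (c : Fin N → F) (a b : F) :
    Algebra.trace (ZMod 2) F (a * ∑ i, c i * b ^ 2 ^ (i : ℕ)) =
      Algebra.trace (ZMod 2) F ((∑ i, (c i * a) ^ 2 ^ (N - (i : ℕ))) * b) := by
  rw [Finset.mul_sum, Finset.sum_mul, map_sum, map_sum]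
  refine Finset.sum_congr rfl fun i _ => ?_
  rw [← trace_pow_two_pow i (_ * b), mul_pow, ← pow_mul, ← pow_add, Nat.sub_add_cancel i.2.le,
    ← hF, FiniteField.pow_card]
  ring_nf

/-- If `Tr (x ^ (q + 1)) + L x` is injective, `L` maps no element outside the subfield with `q`
elements into that subfield. -/
theorem pow_eq_self_of_injective_powSumTrace_add [CharP F 2] {m n : ℕ} (hn : Odd n)
    (hF : Fintype.card F = 2 ^ (m * n)) (L : F →+ F)
    (hinj : Function.Injective fun x => powSumTrace (2 ^ m) n (x ^ (2 ^ m + 1)) + L x)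
    {a : F} (ha : L a ^ 2 ^ m = L a) : a ^ 2 ^ m = a := by
  have hcard (x : F) : x ^ (2 ^ m) ^ n = x := by rw [← pow_mul, ← hF, FiniteField.pow_card]
  obtain ⟨k, rfl⟩ := hn
  by_contra hne
  set w := a ^ 2 ^ m + a ^ (2 ^ m) ^ (2 * k) with hw
  have hw0 : w ≠ 0 := fun h0 => hne <| by
    refine pow_eq_self_of_pow_sq_eq_self ⟨k, rfl⟩ (hcard a) ?_
    rw [sq, pow_mul, CharTwo.add_eq_zero.1 h0, ← pow_mul, ← pow_succ, hcard]
  set d := powSumTrace (2 ^ m) (2 * k + 1) (a ^ (2 ^ m + 1)) + L a with hd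
  have hdK : d ^ 2 ^ m = d := by
    rw [hd, add_pow_char_pow, powSumTrace_pow_eq_self (hcard _), ha]
  set x := d / w with hx
  have hxw : powSumTrace (2 ^ m) (2 * k + 1) (x ^ 2 ^ m * a + x * a ^ 2 ^ m) = d := by
    have h1 : x ^ 2 ^ m * a = (x * a ^ (2 ^ m) ^ (2 * k)) ^ 2 ^ m := by
      rw [mul_pow, ← pow_mul a, ← pow_succ, hcard]
    rw [powSumTrace_add, h1, powSumTrace_pow (hcard _), ← powSumTrace_add,
      ← mul_add, add_comm (a ^ _), ← hw, hx, div_mul_cancel₀ _ hw0,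
      powSumTrace_eq_self ⟨k, rfl⟩ hdK]
  have heq : x + a = x := hinj <| by
    have h1 : (x + a) ^ (2 ^ m + 1) =
        x ^ (2 ^ m + 1) + (x ^ 2 ^ m * a + x * a ^ 2 ^ m) + a ^ (2 ^ m + 1) := by
      rw [pow_succ, add_pow_char_pow]; ring
    simp only [h1, powSumTrace_add, map_add]
    rw [← powSumTrace_add, hxw, hd]
    linear_combination (powSumTrace (2 ^ m) (2 * k + 1) (a ^ (2 ^ m + 1)) + L a) *
      CharTwo.two_eq_zero (R := F)
  apply hne
  simp [left_eq_add.1 heq.symm]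

end FiniteField


/-- Let `n` be odd, `q = 2^m`, `F` the field with `q^n` elements, `L` a
`2`-linear polynomial over `F` such that `Tr(x^(q+1)) + L(x)` is a permutation polynomial of
`F`, and `λ` a `2`-linear polynomial over `F` with adjoint `λ'` such that
`λ'(ker Tr) = ker Tr` and `Tr(λ'(x)) = Tr(x)` for all `x`.  Then both
`Tr(x^(q+1)) + L(λ(x))` and `Tr(x^(q+1)) + λ(L(x))` are permutation polynomials of `F`. -/
theorem stmt_12 (m n : ℕ) (hm : 0 < m) (hn : Odd n)
    (F : Type*) [Field F] [Fintype F] (hF : Fintype.card F = 2 ^ (m * n))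
    (Lc lc : Fin (m * n) → F)
    (L lam lam' Tr : F → F)
    (hL : ∀ x, L x = ∑ i : Fin (m * n), Lc i * x ^ 2 ^ (i : ℕ))
    (hlam : ∀ x, lam x = ∑ i : Fin (m * n), lc i * x ^ 2 ^ (i : ℕ))
    (hlam' : ∀ x, lam' x = ∑ i : Fin (m * n), (lc i * x) ^ 2 ^ (m * n - (i : ℕ)))
    (hTr : ∀ x, Tr x = ∑ i ∈ Finset.range n, x ^ (2 ^ m) ^ i)
    (hbij : Function.Bijective (fun x : F => Tr (x ^ (2 ^ m + 1)) + L x))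
    (h1 : lam' '' {x : F | Tr x = 0} = {x : F | Tr x = 0})
    (h2 : ∀ x, Tr (lam' x) = Tr x) :
    Function.Bijective (fun x : F => Tr (x ^ (2 ^ m + 1)) + L (lam x)) ∧
    Function.Bijective (fun x : F => Tr (x ^ (2 ^ m + 1)) + lam (L x)) := by
  have h2F : CharP F 2 := by
    obtain ⟨p, hp⟩ := CharP.exists F
    have : Fact p.Prime := ⟨CharP.char_is_prime F p⟩
    obtain ⟨r, hpr, hr⟩ := FiniteField.card F p
    have hdvd : p ∣ 2 ^ (m * n) := hF ▸ hr ▸ dvd_pow_self p r.ne_zero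
    rwa [← (Nat.prime_dvd_prime_iff_eq hpr Nat.prime_two).1 (hpr.dvd_of_dvd_pow hdvd)]
  let _ : Algebra (ZMod 2) F := ZMod.algebra F 2
  obtain rfl : Tr = powSumTrace (2 ^ m) n := funext hTr
  have hcard (x : F) : x ^ (2 ^ m) ^ n = x := by rw [← pow_mul, ← hF, FiniteField.pow_card]
  have hL_add (x y : F) : L (x + y) = L x + L y := by
    simp only [hL, sum_mul_two_pow_add]
  have hlam_add (x y : F) : lam (x + y) = lam x + lam y := by
    simp only [hlam, sum_mul_two_pow_add]
  have hlam'_add (x y : F) : lam' (x + y) = lam' x + lam' y := by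
    simp [hlam', mul_add, add_pow_char_pow, Finset.sum_add_distrib]
  have hadj (a b : F) : Algebra.trace (ZMod 2) F (a * lam b) =
      Algebra.trace (ZMod 2) F (lam' a * b) := by
    rw [hlam, hlam', trace_mul_sum_eq_trace_sum_mul hF]
  have hfix {c : F} (hc : c ^ 2 ^ m = c) : lam c = c := by
    rw [← CharTwo.add_eq_zero]
    refine eq_zero_of_trace_mul_eq_zero fun a => ?_
    rw [mul_add, map_add, hadj, CharTwo.add_eq_zero]
    apply (algebraMap (ZMod 2) F).injective
    simp only [algebraMap_trace_eq_sum_powSumTrace hF, mul_comm _ c, powSumTrace_mul hc, h2]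
  have hsurj (y : F) : ∃ z, lam' z = y := by
    have hy : y + lam' y ∈ {x : F | powSumTrace (2 ^ m) n x = 0} := by
      simp [powSumTrace_add, h2, CharTwo.add_self_eq_zero]
    rw [← h1] at hy
    obtain ⟨z, -, hz⟩ := hy
    exact ⟨z + y, by rw [hlam'_add, hz, add_assoc, CharTwo.add_self_eq_zero, add_zero]⟩
  have hlam_inj : Function.Injective lam := by
    refine (injective_iff_map_eq_zero (AddMonoidHom.mk' lam hlam_add)).2 fun b hb => ?_
    refine eq_zero_of_trace_mul_eq_zero fun a => ?_
    obtain ⟨z, rfl⟩ := hsurj a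
    rw [← hadj, show lam b = 0 from hb, mul_zero, map_zero]
  have hL0 : L 0 = 0 := map_zero (AddMonoidHom.mk' L hL_add)
  constructor
  · refine Finite.injective_iff_bijective.1 fun x y hxy => ?_
    obtain ⟨a, rfl⟩ : ∃ a, y = x + a := ⟨y - x, by ring⟩
    simp only [hlam_add, hL_add] at hxy
    have hLa : L (lam a) = powSumTrace (2 ^ m) n (x ^ (2 ^ m + 1)) +
        powSumTrace (2 ^ m) n ((x + a) ^ (2 ^ m + 1)) := by
      linear_combination -hxy - powSumTrace (2 ^ m) n ((x + a) ^ (2 ^ m + 1)) *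
        CharTwo.two_eq_zero (R := F)
    have hlamK : lam a ^ 2 ^ m = lam a := by
      refine pow_eq_self_of_injective_powSumTrace_add hn hF (AddMonoidHom.mk' L hL_add)
        hbij.1 ?_
      simp only [AddMonoidHom.mk'_apply, hLa, add_pow_char_pow,
        powSumTrace_pow_eq_self (hcard _)]
    have hlama : lam a = a := hlam_inj (hfix hlamK)
    rw [hlama] at hlamK hLa
    have hpow : (x + a) ^ (2 ^ m + 1) =
        x ^ (2 ^ m + 1) + a * x ^ 2 ^ m + a * x + a ^ (2 ^ m + 1) := by
      rw [pow_succ, add_pow_char_pow, hlamK, pow_succ a, hlamK]; ring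
    have ha : a = 0 := hbij.1 <| by
      simp only [hpow, powSumTrace_add, powSumTrace_mul hlamK, powSumTrace_pow (hcard x)] at hLa
      simp only [hLa, hL0, zero_pow (Nat.succ_ne_zero _),
        powSumTrace_zero (pow_ne_zero m two_ne_zero)]
      linear_combination (powSumTrace (2 ^ m) n (x ^ (2 ^ m + 1)) + a * powSumTrace (2 ^ m) n x +
        powSumTrace (2 ^ m) n (a ^ (2 ^ m + 1))) * CharTwo.two_eq_zero (R := F)
    rw [ha, add_zero]
  · convert (Finite.injective_iff_bijective.1 hlam_inj).comp hbij using 1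
    funext x
    simp [hlam_add, hfix (powSumTrace_pow_eq_self (hcard _))]
end

section
/- Let n be even and L a 2-linear polynomial over F_{q^n}. Then Tr(x^{q+1}) + L(x) is a permutation polynomial of F_{q^n} if and only if ker(Tr_2 ∘ L') ⊆ ker Tr and ker L = {0}. -/
/-- The sum `∑ i < k, x ^ (2 ^ r) ^ i` as an additive map in characteristic two; it is the trace
to `𝔽_(2 ^ r)` when the field has `2 ^ (r * k)` elements. -/
def powTrace (F : Type*) [Field F] [CharP F 2] (r k : ℕ) : F →+ F :=
  ∑ i ∈ Finset.range k, (iterateFrobenius F 2 (r * i)).toAddMonoidHom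

lemma pow_two_pow_mul_of_fixed {F : Type*} [Field F] {r : ℕ} {c : F} (hc : c ^ 2 ^ r = c) (i : ℕ) :
    c ^ 2 ^ (r * i) = c := by
  induction i with
  | zero => simp
  | succ i ih => rw [Nat.mul_succ, pow_add, pow_mul, ih, hc]

section PowTrace

variable {F : Type*} [Field F] [CharP F 2]

lemma powTrace_apply (r k : ℕ) (x : F) :
    powTrace F r k x = ∑ i ∈ Finset.range k, x ^ 2 ^ (r * i) := by
  simp [powTrace, iterateFrobenius_def]

lemma add_pow_two_pow (k : ℕ) (x y : F) : (x + y) ^ 2 ^ k = x ^ 2 ^ k + y ^ 2 ^ k :=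
  add_pow_char_pow x y 2 k

lemma sum_pow_two_pow {ι : Type*} (k : ℕ) (s : Finset ι) (f : ι → F) :
    (∑ i ∈ s, f i) ^ 2 ^ k = ∑ i ∈ s, f i ^ 2 ^ k :=
  sum_pow_char_pow 2 k s f

lemma powTrace_mul_of_fixed {r : ℕ} (k : ℕ) {c : F} (hc : c ^ 2 ^ r = c) (x : F) :
    powTrace F r k (c * x) = c * powTrace F r k x := by
  simp_rw [powTrace_apply, mul_pow, pow_two_pow_mul_of_fixed hc, Finset.mul_sum]

lemma powTrace_of_fixed {r : ℕ} (k : ℕ) {c : F} (hc : c ^ 2 ^ r = c) :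
    powTrace F r k c = k * c := by
  simp_rw [powTrace_apply, pow_two_pow_mul_of_fixed hc]
  simp

lemma powTrace_pow {r k : ℕ} {x : F} (hx : x ^ 2 ^ (r * k) = x) :
    powTrace F r k (x ^ 2 ^ r) = powTrace F r k x := by
  simp_rw [powTrace_apply, ← pow_mul, ← pow_add]
  have h := Finset.sum_range_succ' (fun i => x ^ 2 ^ (r * i)) k
  rw [Finset.sum_range_succ, hx] at h
  simp only [mul_zero, pow_zero, pow_one] at h
  rw [add_right_cancel h]
  simp only [Nat.mul_succ, add_comm]

lemma powTrace_pow_eq_pow (r k j : ℕ) (x : F) :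
    powTrace F r k (x ^ 2 ^ j) = powTrace F r k x ^ 2 ^ j := by
  simp_rw [powTrace_apply, sum_pow_two_pow, ← pow_mul, mul_comm]

lemma powTrace_fixed {r k : ℕ} {x : F} (hx : x ^ 2 ^ (r * k) = x) :
    powTrace F r k x ^ 2 ^ r = powTrace F r k x := by
  rw [← powTrace_pow_eq_pow, powTrace_pow hx]

lemma powTrace_trans (r k : ℕ) (x : F) :
    powTrace F 1 r (powTrace F r k x) = powTrace F 1 (r * k) x := by
  induction k with
  | zero => simp [powTrace]
  | succ k ih =>
    have h : powTrace F r (k + 1) x = powTrace F r k x + x ^ 2 ^ (r * k) := by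
      simp_rw [powTrace_apply, Finset.sum_range_succ]
    rw [h, map_add, ih, Nat.mul_succ, powTrace_apply _ _ x, powTrace_apply,
      powTrace_apply, Finset.sum_range_add]
    simp only [one_mul, ← pow_mul, ← pow_add]

lemma powTrace_one_pow {N : ℕ} (hN : ∀ x : F, x ^ 2 ^ N = x) (j : ℕ) (x : F) :
    powTrace F 1 N (x ^ 2 ^ j) = powTrace F 1 N x := by
  induction j with
  | zero => simp
  | succ j ih =>
    rw [pow_succ, pow_mul, ← ih]
    exact powTrace_pow (r := 1) (by rw [one_mul, hN])

lemma powTrace_one_adjoint {N : ℕ} (hN : ∀ x : F, x ^ 2 ^ N = x) (a : Fin N → F) (x v : F) :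
    powTrace F 1 N ((∑ i : Fin N, a i * x ^ 2 ^ (i : ℕ)) * v) =
      powTrace F 1 N (x * ∑ i : Fin N, (a i * v) ^ 2 ^ (N - (i : ℕ))) := by
  rw [Finset.sum_mul, Finset.mul_sum, map_sum, map_sum]
  refine Finset.sum_congr rfl fun i _ => ?_
  rw [← powTrace_one_pow hN i (x * _), mul_pow, ← pow_mul, ← pow_add,
    Nat.sub_add_cancel i.2.le, hN]
  congr 1
  ring

lemma exists_powTrace_one_ne_zero [Fintype F] {N : ℕ} (hF : Fintype.card F = 2 ^ N) :
    ∃ x : F, powTrace F 1 N x ≠ 0 := by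
  let := ZMod.algebra F 2
  obtain ⟨x, hx⟩ := Algebra.trace_surjective (ZMod 2) F 1
  have hfin : Module.finrank (ZMod 2) F = N := by
    refine Nat.pow_right_injective le_rfl ?_
    simpa [hF] using (Module.card_eq_pow_finrank (K := ZMod 2) (V := F)).symm
  refine ⟨x, ?_⟩
  have h := FiniteField.algebraMap_trace_eq_sum_pow (ZMod 2) F x
  rw [hx, map_one, hfin, Nat.card_zmod] at h
  simp [powTrace_apply, ← h]

lemma eq_zero_of_powTrace_one_mul [Fintype F] {N : ℕ} (hF : Fintype.card F = 2 ^ N) {b : F}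
    (hb : ∀ x, powTrace F 1 N (x * b) = 0) : b = 0 := by
  by_contra hb0
  obtain ⟨x, hx⟩ := exists_powTrace_one_ne_zero hF
  exact hx (by simpa [hb0] using hb (x / b))

lemma exists_powTrace_mul_eq [Fintype F] {r k : ℕ} (hF : Fintype.card F = 2 ^ (r * k)) {b c : F}
    (hb : b ≠ 0) (hc : c ^ 2 ^ r = c) : ∃ x, powTrace F r k (x * b) = c := by
  obtain ⟨z, hz⟩ := exists_powTrace_one_ne_zero hF
  have hz' : powTrace F r k z ≠ 0 := fun h => hz (by rw [← powTrace_trans, h, map_zero])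
  have hfix := powTrace_fixed (r := r) (k := k) (x := z) (by rw [← hF, FiniteField.pow_card])
  refine ⟨c / powTrace F r k z * z / b, ?_⟩
  rw [div_mul_cancel₀ _ hb, powTrace_mul_of_fixed _ (by rw [div_pow, hc, hfix]),
    div_mul_cancel₀ _ hz']

lemma powTrace_eq_zero_of_powTrace_one_mul [Fintype F] {r k : ℕ}
    (hF : Fintype.card F = 2 ^ (r * k)) {v : F}
    (hv : ∀ c : F, c ^ 2 ^ r = c → powTrace F 1 (r * k) (c * v) = 0) : powTrace F r k v = 0 := by
  by_contra h
  have hfix (z : F) : powTrace F r k z ^ 2 ^ r = powTrace F r k z :=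
    powTrace_fixed (by rw [← hF, FiniteField.pow_card])
  obtain ⟨z, hz⟩ := exists_powTrace_one_ne_zero hF
  apply hz
  have hc : (powTrace F r k z / powTrace F r k v) ^ 2 ^ r =
      powTrace F r k z / powTrace F r k v := by
    rw [div_pow, hfix, hfix]
  have := hv _ hc
  rwa [← powTrace_trans, powTrace_mul_of_fixed _ hc, div_mul_cancel₀ _ h, powTrace_trans] at this

/-- An element orthogonal to `ker (powTrace F r k)` lies in `𝔽_(2 ^ r)`. -/
lemma fixed_of_powTrace_one_mul [Fintype F] {r k : ℕ} (hF : Fintype.card F = 2 ^ (r * k)) {x : F}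
    (hx : ∀ y, powTrace F r k y = 0 → powTrace F 1 (r * k) (x * y) = 0) : x ^ 2 ^ r = x := by
  have hN (y : F) : y ^ 2 ^ (r * k) = y := by rw [← hF, FiniteField.pow_card]
  rw [← CharTwo.add_eq_zero]
  refine eq_zero_of_powTrace_one_mul hF fun w => ?_
  obtain ⟨z, rfl⟩ : ∃ z : F, z ^ 2 ^ r = w :=
    Finite.injective_iff_surjective.1 (iterateFrobenius F 2 r).injective w
  have h := hx (z + z ^ 2 ^ r) (by rw [map_add, powTrace_pow (hN z), CharTwo.add_self_eq_zero])
  rw [mul_add, map_add, ← powTrace_one_pow hN r (x * z), mul_pow] at h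
  rw [mul_comm (z ^ 2 ^ r), add_mul, map_add, h]

/-- The polynomial `Tr (x ^ (q + 1)) + L x` permutes `F` iff `L` is injective and
`L ⁻¹ 𝔽_q ⊆ 𝔽_(q ^ 2)`. -/
lemma bijective_powTrace_add_iff [Fintype F] {m n : ℕ} (hn : Even n)
    (hF : Fintype.card F = 2 ^ (m * n)) (L : F →+ F) :
    Function.Bijective (fun x : F => powTrace F m n (x ^ (2 ^ m + 1)) + L x) ↔
      (∀ x, L x ^ 2 ^ m = L x → x ^ 2 ^ (2 * m) = x) ∧ ∀ x, L x = 0 → x = 0 := by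
  have hN (y : F) : y ^ 2 ^ (m * n) = y := by rw [← hF, FiniteField.pow_card]
  have hadd (x u : F) : powTrace F m n ((x + u) ^ (2 ^ m + 1)) + L (x + u) =
      powTrace F m n (x ^ (2 ^ m + 1)) + L x +
        (powTrace F m n (x ^ 2 ^ m * u + x * u ^ 2 ^ m) + powTrace F m n (u ^ (2 ^ m + 1)) + L u) := by
    have : (x + u) ^ (2 ^ m + 1) =
        x ^ (2 ^ m + 1) + (x ^ 2 ^ m * u + x * u ^ 2 ^ m) + u ^ (2 ^ m + 1) := by
      rw [pow_succ, add_pow_two_pow]; ring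
    rw [this, map_add, map_add, map_add L]; ring
  have hmid (x b : F) : powTrace F m n (x ^ 2 ^ m * b ^ 2 ^ m + x * (b ^ 2 ^ m) ^ 2 ^ m) =
      powTrace F m n (x * (b + b ^ 2 ^ (2 * m))) := by
    rw [map_add, ← mul_pow, powTrace_pow (hN _), ← map_add, ← pow_mul, ← pow_add, two_mul, mul_add]
  have hsurj (u : F) : ∃ b : F, b ^ 2 ^ m = u :=
    (Finite.injective_iff_surjective.1 (iterateFrobenius F 2 m).injective) u
  have hnorm (u : F) (hu : u ^ 2 ^ (2 * m) = u) : powTrace F m n (u ^ (2 ^ m + 1)) = 0 := by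
    rw [powTrace_of_fixed, (CharP.cast_eq_zero_iff F 2 n).2 hn.two_dvd, zero_mul]
    rw [two_mul, pow_add, pow_mul] at hu
    rw [← pow_mul, mul_comm, pow_mul, pow_succ (u ^ 2 ^ m), hu, pow_succ, mul_comm]
  have hfix (z : F) : powTrace F m n z ^ 2 ^ m = powTrace F m n z := powTrace_fixed (hN z)
  rw [← Finite.injective_iff_bijective]
  constructor
  · intro hinj
    have hne (x u : F) (h : powTrace F m n (x ^ 2 ^ m * u + x * u ^ 2 ^ m) +
        powTrace F m n (u ^ (2 ^ m + 1)) + L u = 0) : u = 0 := by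
      have : x + u = x := hinj (by simp only [hadd x u, h, add_zero])
      simpa using this
    have hmem (x : F) (hx : L x ^ 2 ^ m = L x) : x ^ 2 ^ (2 * m) = x := by
      by_contra hx'
      obtain ⟨b, rfl⟩ := hsurj x
      have hb : b + b ^ 2 ^ (2 * m) ≠ 0 := fun h => hx' <| by
        rw [← pow_mul, mul_comm, pow_mul, ← CharTwo.add_eq_zero.1 h]
      obtain ⟨y, hy⟩ := exists_powTrace_mul_eq hF hb
        (c := powTrace F m n ((b ^ 2 ^ m) ^ (2 ^ m + 1)) + L (b ^ 2 ^ m))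
        (by rw [add_pow_two_pow, hfix, hx])
      refine hx' ?_
      rw [hne y (b ^ 2 ^ m) (by rw [hmid, hy, add_assoc, CharTwo.add_self_eq_zero])]
      simp
    refine ⟨hmem, fun x hx => hne 0 x ?_⟩
    rw [hnorm x (hmem x (by simp [hx])), hx]
    simp
  · rintro ⟨hmem, hker⟩ x y hxy
    obtain ⟨u, rfl⟩ : ∃ u, y = x + u := ⟨y - x, by ring⟩
    simp only [hadd x u, left_eq_add] at hxy
    rw [CharTwo.add_eq_zero] at hxy
    have hu : u ^ 2 ^ (2 * m) = u := hmem u (by rw [← hxy, add_pow_two_pow, hfix, hfix])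
    obtain ⟨b, rfl⟩ := hsurj u
    have hb : b ^ 2 ^ (2 * m) = b := by
      rw [← pow_mul, mul_comm, pow_mul] at hu
      exact (iterateFrobenius F 2 m).injective hu
    rw [hmid, hnorm _ hu, hb, CharTwo.add_self_eq_zero, mul_zero, map_zero, add_zero] at hxy
    rw [hker _ hxy.symm, add_zero]

end PowTrace

theorem stmt_14 (m n : ℕ) (hm : 0 < m) (hn : Even n) (hn0 : 0 < n)
    (F : Type*) [Field F] [Fintype F] (hF : Fintype.card F = 2 ^ (m * n))
    (a : Fin (m * n) → F)
    (L L' Tr Tr2 : F → F)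
    (hL : ∀ x, L x = ∑ i : Fin (m * n), a i * x ^ 2 ^ (i : ℕ))
    (hL' : ∀ x, L' x = ∑ i : Fin (m * n), (a i * x) ^ 2 ^ (m * n - (i : ℕ)))
    (hTr : ∀ x, Tr x = ∑ i ∈ Finset.range n, x ^ (2 ^ m) ^ i)
    (hTr2 : ∀ x, Tr2 x = ∑ i ∈ Finset.range (n / 2), x ^ ((2 ^ m) ^ 2) ^ i) :
    Function.Bijective (fun x : F => Tr (x ^ (2 ^ m + 1)) + L x) ↔
      ({x : F | Tr2 (L' x) = 0} ⊆ {x : F | Tr x = 0} ∧ ∀ x : F, L x = 0 → x = 0) := by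
  have : CharP F 2 := charP_of_card_eq_prime_pow hF
  have hN (x : F) : x ^ 2 ^ (m * n) = x := by rw [← hF, FiniteField.pow_card]
  have hmn : 2 * m * (n / 2) = m * n := by
    rw [mul_comm 2 m, mul_assoc, Nat.mul_div_cancel' hn.two_dvd]
  have hF2 : Fintype.card F = 2 ^ (2 * m * (n / 2)) := by rw [hF, hmn]
  obtain rfl : Tr = powTrace F m n := by
    ext x; simp_rw [hTr, powTrace_apply, ← pow_mul]
  obtain rfl : Tr2 = powTrace F (2 * m) (n / 2) := by
    ext x; simp_rw [hTr2, powTrace_apply, ← pow_mul, mul_comm 2 m]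
  have hLadd (x y : F) : L (x + y) = L x + L y := by
    simp_rw [hL, add_pow_two_pow, mul_add, Finset.sum_add_distrib]
  have hL'add (x y : F) : L' (x + y) = L' x + L' y := by
    simp_rw [hL', mul_add, add_pow_two_pow, Finset.sum_add_distrib]
  obtain ⟨Lh, rfl⟩ : ∃ f : F →+ F, L = f := ⟨AddMonoidHom.mk' L hLadd, rfl⟩
  obtain ⟨Lh', rfl⟩ : ∃ f : F →+ F, L' = f := ⟨AddMonoidHom.mk' L' hL'add, rfl⟩
  have hadj (x v : F) : powTrace F 1 (m * n) (Lh x * v) = powTrace F 1 (m * n) (x * Lh' v) := by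
    rw [hL, hL', powTrace_one_adjoint hN]
  rw [bijective_powTrace_add_iff hn hF]
  refine and_congr_left fun hker => ?_
  have hLsurj : Function.Surjective Lh :=
    Finite.injective_iff_surjective.1 ((injective_iff_map_eq_zero Lh).2 hker)
  have hL'surj : Function.Surjective Lh' := by
    refine Finite.injective_iff_surjective.1 ((injective_iff_map_eq_zero Lh').2 fun v hv => ?_)
    refine eq_zero_of_powTrace_one_mul hF fun y => ?_
    obtain ⟨x, rfl⟩ := hLsurj y
    rw [hadj, hv, mul_zero, map_zero]
  constructor
  · intro h v hv
    refine powTrace_eq_zero_of_powTrace_one_mul hF fun c hc => ?_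
    obtain ⟨x, rfl⟩ := hLsurj c
    have hv' : powTrace F (2 * m) (n / 2) (Lh' v) = 0 := hv
    rw [hadj, ← hmn, ← powTrace_trans, powTrace_mul_of_fixed _ (h x hc), hv', mul_zero, map_zero]
  · intro h x hx
    refine fixed_of_powTrace_one_mul hF2 fun y hy => ?_
    obtain ⟨v, rfl⟩ := hL'surj y
    have hv : powTrace F m n v = 0 := h hy
    rw [hmn, ← hadj, ← powTrace_trans, powTrace_mul_of_fixed _ hx, hv, mul_zero, map_zero]
end
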